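/- arXiv:2602.05511 — 3 statements merged into one kernel-verified Lean document; each statement's English description precedes it below -/
import Mathlib

section
/- Let s be a complex number with Re s > 0 and s ≠ 1, and let ℓ ≥ 2 be an integer. Then the series ∑_{m=0}^∞ (−1)^m (s·c*_{m,2}(s)/(s+m)) ∑_{2^{ℓ−1} ≤ n < 2^ℓ} n^{−s−m} converges absolutely, and ((2^s − 2)/2^s)·ζ(s) = ((2^s − 2)/2^s) ∑_{0 < n < 2^{ℓ−1}} n^{−s} + ∑_{m=0}^∞ (−1)^m (s·c*_{m,2}(s)/(s+m)) ∑_{2^{ℓ−1} ≤ n < 2^ℓ} n^{−s−m}, where ζ is the Riemann zeta function. -/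
open Finset

/-- γ_{j,b} = ∑_{a=1}^{b-1} a^j for a natural exponent j. -/
def gammaNat (b j : ℕ) : ℕ := ∑ a ∈ Finset.Ico 1 b, a ^ j

/-- The coefficients c*_{m,b}(s): c*_{0,b}(s) = 1 and, for m ≥ 1,
c*_{m,b}(s) = (1/(b^{s+m} − b)) ∑_{j=1}^{m} [(s+m)⋯(s+m−j+1)/j!] γ_{j,b} c*_{m−j,b}(s). -/
noncomputable def cstarC (b : ℕ) (s : ℂ) : ℕ → ℂ
  | 0 => 1
  | (m + 1) =>
      (1 / ((b : ℂ) ^ (s + (m : ℂ) + 1) - (b : ℂ))) *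
        ∑ j ∈ Finset.range (m + 1),
          ((∏ i ∈ Finset.range (j + 1), (s + (m : ℂ) + 1 - (i : ℂ))) / (Nat.factorial (j + 1) : ℂ))
            * (gammaNat b (j + 1) : ℂ) * cstarC b s (m - j)
  decreasing_by exact Nat.lt_succ_of_le (Nat.sub_le m j)


/-- rising binomial coefficient a(a+1)...(a+j-1)/j! -/
noncomputable def rb (a : ℂ) (j : ℕ) : ℂ := (∏ i ∈ Finset.range j, (a + (i : ℂ))) / (Nat.factorial j : ℂ)

/-- coefficients of the series -/
noncomputable def dco (s : ℂ) (m : ℕ) : ℂ := (-1 : ℂ) ^ m * (s * cstarC 2 s m / (s + (m : ℂ)))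

theorem choose_neg_rb (a : ℂ) (j : ℕ) : Ring.choose (-a) j = (-1) ^ j * rb a j := by
  rw [Ring.choose_eq_smul, rb]
  have h : (descPochhammer ℤ j).smeval (-a) = (-1) ^ j * ∏ i ∈ Finset.range j, (a + (i : ℂ)) := by
    induction j with
    | zero => simp
    | succ n ih =>
      rw [descPochhammer_succ_right, Polynomial.smeval_mul, ih, Finset.prod_range_succ]
      simp [Polynomial.smeval_sub, Polynomial.smeval_natCast]
      ring
  rw [h, smul_eq_mul]
  ring

theorem binom_hasSum (a x : ℂ) (hx : ‖x‖ < 1) :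
    HasSum (fun j : ℕ => ((-1) ^ j * rb a j) * x ^ j) ((1 + x) ^ (-a)) := by
  have h := (Complex.one_add_cpow_hasFPowerSeriesOnBall_zero (a := -a)).hasSum (y := x)
    (by rw [← ENNReal.ofReal_one, Metric.eball_ofReal]; simpa using hx)
  simpa [binomialSeries, FormalMultilinearSeries.coeff_ofScalars, choose_neg_rb, mul_comm, mul_left_comm] using h

theorem prod_shift (t : ℂ) (j : ℕ) :
    (t + j) * ∏ i ∈ Finset.range j, (t + (i : ℂ)) = t * ∏ i ∈ Finset.range j, (t + j - (i : ℂ)) := by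
  have h1 : ∏ i ∈ Finset.range j, (t + j - (i : ℂ)) = ∏ i ∈ Finset.range j, (t + ((i + 1 : ℕ) : ℂ)) := by
    rw [← Finset.prod_range_reflect]
    refine Finset.prod_congr rfl fun i hi => ?_
    have : i + 1 ≤ j := by simpa [Nat.succ_le_iff] using hi
    rw [show j - 1 - i = j - (i + 1) by omega, Nat.cast_sub this]
    ring
  have h2 := Finset.prod_range_succ' (fun i : ℕ => t + (i : ℂ)) j
  rw [Finset.prod_range_succ] at h2
  rw [h1, mul_comm, h2]
  simp [mul_comm]

theorem s_add_ne (s : ℂ) (hs : 0 < s.re) (m : ℕ) : s + (m : ℂ) ≠ 0 := by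
  intro h
  have := congrArg Complex.re h
  simp at this
  have : (0 : ℝ) ≤ m := by positivity
  linarith

theorem two_norm (s : ℂ) (m : ℕ) : ‖(2 : ℂ) ^ (s + (m : ℂ))‖ = 2 ^ s.re * 2 ^ m := by
  have := Complex.norm_natCast_cpow_of_pos (n := 2) (by norm_num) (s + m)
  simp at this
  rw [this, Real.rpow_add (by norm_num)]
  simp

theorem pow_sub_lower (s : ℂ) (hs : 0 < s.re) (m : ℕ) :
    (2 : ℝ) ^ m - 2 ≤ ‖(2 : ℂ) ^ (s + (m : ℂ)) - 2‖ := by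
  have h := norm_sub_norm_le ((2 : ℂ) ^ (s + (m : ℂ))) 2
  rw [two_norm] at h
  have h1 : (1 : ℝ) ≤ 2 ^ s.re := Real.one_le_rpow (by norm_num) hs.le
  have h2 : (0 : ℝ) < 2 ^ m := by positivity
  simp at h
  nlinarith

theorem pow_sub_ne (s : ℂ) (hs : 0 < s.re) (m : ℕ) : (2 : ℂ) ^ (s + (m : ℂ) + 1) - 2 ≠ 0 := by
  intro h
  have h1 : ‖(2 : ℂ) ^ (s + ((m + 1 : ℕ) : ℂ))‖ = 2 := by
    push_cast
    rw [← add_assoc, sub_eq_zero.1 h]; simp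
  rw [two_norm] at h1
  have h2 : (1 : ℝ) < 2 ^ s.re := Real.one_lt_rpow (by norm_num) hs
  have h3 : (1 : ℝ) ≤ 2 ^ m := one_le_pow₀ (by norm_num)
  rw [pow_succ] at h1
  nlinarith

theorem cstar_rec (s : ℂ) (hs : 0 < s.re) (m : ℕ) :
    ((2 : ℂ) ^ (s + (m : ℂ) + 1) - 2) * cstarC 2 s (m + 1) =
      ∑ j ∈ Finset.range (m + 1), ((∏ i ∈ Finset.range (j + 1), (s + (m : ℂ) + 1 - (i : ℂ))) /
        (Nat.factorial (j + 1) : ℂ)) * cstarC 2 s (m - j) := by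
  rw [cstarC]
  have := pow_sub_ne s hs m
  simp only [Nat.cast_ofNat]
  rw [one_div, mul_inv_cancel_left₀ this]
  simp [gammaNat]

theorem dco_rec (s : ℂ) (hs : 0 < s.re) (m : ℕ) :
    ∑ p ∈ Finset.HasAntidiagonal.antidiagonal (m + 1), dco s p.1 * ((-1) ^ p.2 * rb (s + p.1) p.2) =
      dco s (m + 1) * ((2 : ℂ) ^ (s + (m : ℂ) + 1) - 1) := by
  rw [Finset.Nat.antidiagonal_succ', Finset.sum_cons]
  simp only [Finset.sum_map]
  have e : ∑ x ∈ Finset.HasAntidiagonal.antidiagonal m, dco s x.1 * ((-1) ^ (x.2 + 1) * rb (s + x.1) (x.2 + 1))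
      = dco s (m + 1) * ((2 : ℂ) ^ (s + (m : ℂ) + 1) - 2) := by
    have h := cstar_rec s hs m
    have hd : dco s (m + 1) * ((2 : ℂ) ^ (s + (m : ℂ) + 1) - 2) =
      (-1) ^ (m + 1) * (s / (s + ((m + 1 : ℕ) : ℂ))) * (((2 : ℂ) ^ (s + (m : ℂ) + 1) - 2) * cstarC 2 s (m + 1)) := by
      rw [dco]; ring
    rw [hd, h, Finset.mul_sum]
    rw [← Finset.Nat.sum_antidiagonal_swap, Finset.Nat.sum_antidiagonal_eq_sum_range_succ_mk]
    refine Finset.sum_congr rfl fun j hj => ?_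
    have hj : j ≤ m := by simpa [Nat.lt_succ_iff] using hj
    obtain ⟨k, rfl⟩ := Nat.exists_eq_add_of_le hj
    simp only [Prod.fst_swap, Prod.snd_swap, Nat.add_sub_cancel_left]
    rw [dco, rb]
    have p := prod_shift (s + k) (j + 1)
    have n1 := s_add_ne s hs k
    have n2 := s_add_ne s hs (j + k + 1)
    have n3 : ((Nat.factorial (j + 1) : ℕ) : ℂ) ≠ 0 := by exact_mod_cast Nat.factorial_ne_zero _
    have q : ∏ i ∈ Finset.range (j + 1), (s + ((j + k : ℕ) : ℂ) + 1 - (i : ℂ)) =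
      ∏ i ∈ Finset.range (j + 1), (s + k + ((j + 1 : ℕ) : ℂ) - (i : ℂ)) := by
      refine Finset.prod_congr rfl fun i _ => ?_
      push_cast; ring
    rw [q]
    generalize ∏ i ∈ Finset.range (j + 1), (s + k + ((j + 1 : ℕ) : ℂ) - (i : ℂ)) = P at *
    generalize ∏ i ∈ Finset.range (j + 1), (s + k + (i : ℂ)) = Q at *
    have p' : Q / (s + k) = P / (s + ((j + k + 1 : ℕ) : ℂ)) := by
      rw [div_eq_div_iff n1 n2]
      push_cast at p ⊢
      linear_combination p
    have sg : (-1 : ℂ) ^ k * (-1) ^ (j + 1) = (-1) ^ (j + k + 1) := by ring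
    rw [← sg]
    linear_combination ((-1) ^ k * (-1) ^ (j + 1) * s * cstarC 2 s k / ((Nat.factorial (j + 1) : ℕ) : ℂ)) * p'
  simp only [Function.Embedding.prodMap, Function.Embedding.coeFn_mk, Prod.map, Function.Embedding.refl_apply, Nat.succ_eq_add_one]
  rw [e]
  simp [rb]
  ring

theorem fact_bound (s : ℂ) (m j : ℕ) (hj : j ≤ m) :
    ‖(∏ i ∈ Finset.range j, (s + (m : ℂ) - (i : ℂ))) / (Nat.factorial j : ℂ)‖ ≤
      ((⌈‖s‖⌉₊ + m).choose j : ℝ) := by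
  have hK : ‖s‖ ≤ ⌈‖s‖⌉₊ := Nat.le_ceil _
  set K := ⌈‖s‖⌉₊
  rw [norm_div, div_le_iff₀ (by simp [Nat.factorial_pos]), norm_prod]
  have e : ((K + m).choose j : ℝ) * ‖((Nat.factorial j : ℕ) : ℂ)‖ = ∏ i ∈ Finset.range j, (((K + m - i : ℕ)) : ℝ) := by
    rw [← Nat.cast_prod, ← Nat.descFactorial_eq_prod_range, Nat.descFactorial_eq_factorial_mul_choose]
    simp [mul_comm]
  rw [e]
  refine Finset.prod_le_prod (fun _ _ => norm_nonneg _) fun i hi => ?_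
  have hi : i < j := by simpa using hi
  have : K + m - i = K + (m - i) := by omega
  rw [this]
  have h2 : s + (m : ℂ) - i = s + ((m - i : ℕ) : ℂ) := by
    rw [Nat.cast_sub (by omega)]; ring
  rw [h2]
  refine (norm_add_le _ _).trans ?_
  rw [Complex.norm_natCast]
  push_cast
  linarith

theorem rb_bound (s : ℂ) (m j : ℕ) :
    ‖rb (s + m) j‖ ≤ ((j + (⌈‖s‖⌉₊ + m)).choose (⌈‖s‖⌉₊ + m) : ℝ) := by
  have hK : ‖s‖ ≤ ⌈‖s‖⌉₊ := Nat.le_ceil _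
  set K := ⌈‖s‖⌉₊
  rw [rb, norm_div, div_le_iff₀ (by simp [Nat.factorial_pos]), norm_prod]
  have e : ((j + (K + m)).choose (K + m) : ℝ) * ‖((Nat.factorial j : ℕ) : ℂ)‖ =
      ∏ i ∈ Finset.range j, (((K + m + 1 + i : ℕ)) : ℝ) := by
    rw [← Nat.cast_prod, ← Nat.ascFactorial_eq_prod_range, Nat.ascFactorial_eq_factorial_mul_choose,
      add_comm j, ← Nat.choose_symm_add]
    simp [mul_comm]
  rw [e]
  refine Finset.prod_le_prod (fun _ _ => norm_nonneg _) fun i hi => ?_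
  refine (norm_add_le _ _).trans ?_
  have := norm_add_le s (m : ℂ)
  rw [Complex.norm_natCast] at *
  push_cast
  linarith

theorem growth_step (s : ℂ) (A : ℝ) (hA : 0 ≤ A) (m : ℕ) 
    (ih : ∀ k ≤ m, ‖cstarC 2 s k‖ ≤ A * (3 / 2 : ℝ) ^ k) :
    ‖∑ j ∈ Finset.range (m + 1), ((∏ i ∈ Finset.range (j + 1), (s + (m : ℂ) + 1 - (i : ℂ))) /
        (Nat.factorial (j + 1) : ℂ)) * cstarC 2 s (m - j)‖ ≤
      A * (3 / 2 : ℝ) ^ (m + 1) * (5 / 3 : ℝ) ^ (⌈‖s‖⌉₊ + (m + 1)) := by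
  set K := ⌈‖s‖⌉₊ with hK
  have h1 : ‖∑ j ∈ Finset.range (m + 1), ((∏ i ∈ Finset.range (j + 1), (s + (m : ℂ) + 1 - (i : ℂ))) /
        (Nat.factorial (j + 1) : ℂ)) * cstarC 2 s (m - j)‖ ≤
      ∑ j ∈ Finset.range (m + 1), A * (3 / 2 : ℝ) ^ (m + 1) * ((2 / 3 : ℝ) ^ (j + 1) * (K + (m + 1)).choose (j + 1)) := by
    refine norm_sum_le_of_le _ fun j hj => ?_
    have hj : j ≤ m := by simpa [Nat.lt_succ_iff] using hj
    rw [norm_mul]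
    have f := fact_bound s (m + 1) (j + 1) (by omega)
    have g := ih (m - j) (by omega)
    push_cast at f
    simp only [← add_assoc] at f g ⊢
    refine (mul_le_mul f g (norm_nonneg _) (by positivity)).trans (le_of_eq ?_)
    obtain ⟨k, rfl⟩ := Nat.exists_eq_add_of_le hj
    have : (3 / 2 : ℝ) ^ (j + k + 1) * (2 / 3) ^ (j + 1) = (3 / 2) ^ k := by
      rw [show j + k + 1 = k + (j + 1) by ring, pow_add, mul_assoc, ← mul_pow]; norm_num
    simp only [Nat.add_sub_cancel_left]
    rw [← this]; simp only [← hK]; ring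
  refine h1.trans ?_
  rw [← Finset.mul_sum]
  refine mul_le_mul_of_nonneg_left ?_ (by positivity)
  have b := add_pow (2 / 3 : ℝ) 1 (K + (m + 1))
  rw [show (2 / 3 + 1 : ℝ) = 5 / 3 by norm_num] at b
  rw [b, Finset.sum_range_succ' _ (K + (m + 1))]
  simp only [one_pow, mul_one]
  have : ∑ j ∈ Finset.range (m + 1), (2 / 3 : ℝ) ^ (j + 1) * (K + (m + 1)).choose (j + 1) ≤
     ∑ j ∈ Finset.range (K + (m + 1)), (2 / 3 : ℝ) ^ (j + 1) * (K + (m + 1)).choose (j + 1) :=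
    Finset.sum_le_sum_of_subset_of_nonneg (Finset.range_mono (by omega)) fun _ _ _ => by positivity
  have : (0 : ℝ) ≤ (2 / 3) ^ 0 * ((K + (m + 1)).choose 0 : ℝ) := by positivity
  linarith

theorem ev_bound (K : ℕ) : ∃ M0 : ℕ, 2 ≤ M0 ∧ ∀ M ≥ M0, (5 / 3 : ℝ) ^ (K + M) ≤ 2 ^ M - 2 := by
  have h : Filter.Tendsto (fun M : ℕ => (5 / 3 : ℝ) ^ K * (5 / 6 : ℝ) ^ M) Filter.atTop (nhds ((5 / 3 : ℝ) ^ K * 0)) :=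
    (tendsto_pow_atTop_nhds_zero_of_lt_one (by norm_num) (by norm_num)).const_mul _
  rw [mul_zero] at h
  obtain ⟨M0, h0⟩ := Filter.eventually_atTop.1 (h.eventually_le_const (show (0 : ℝ) < 1 / 2 by norm_num))
  refine ⟨max M0 2, le_max_right _ _, fun M hM => ?_⟩
  have h1 := h0 M (le_trans (le_max_left _ _) hM)
  have h2 : 2 ≤ M := le_trans (le_max_right _ _) hM
  have h3 : (4 : ℝ) ≤ 2 ^ M := by
    calc (4 : ℝ) = 2 ^ 2 := by norm_num
      _ ≤ 2 ^ M := pow_le_pow_right₀ (by norm_num) h2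
  have h4 : (5 / 3 : ℝ) ^ (K + M) = (5 / 3 : ℝ) ^ K * (5 / 6 : ℝ) ^ M * 2 ^ M := by
    rw [pow_add, mul_assoc, ← mul_pow]; norm_num
  rw [h4]
  nlinarith

theorem growth (s : ℂ) (hs : 0 < s.re) :
    ∃ A : ℝ, 0 ≤ A ∧ ∀ m, ‖cstarC 2 s m‖ ≤ A * (3 / 2 : ℝ) ^ m := by
  obtain ⟨M0, h2, hM⟩ := ev_bound ⌈‖s‖⌉₊
  set A := ∑ i ∈ Finset.range M0, ‖cstarC 2 s i‖ with hAd
  have hA : 0 ≤ A := Finset.sum_nonneg fun _ _ => norm_nonneg _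
  refine ⟨A, hA, fun m => ?_⟩
  induction m using Nat.strong_induction_on with
  | _ m ih =>
    by_cases hm : m < M0
    · have h1 : ‖cstarC 2 s m‖ ≤ A :=
        Finset.single_le_sum (f := fun i => ‖cstarC 2 s i‖) (fun _ _ => norm_nonneg _) (by simpa using hm)
      have h3 : (1 : ℝ) ≤ (3 / 2 : ℝ) ^ m := one_le_pow₀ (by norm_num)
      nlinarith
    · obtain ⟨k, rfl⟩ : ∃ k, m = k + 1 := ⟨m - 1, by omega⟩
      have g := growth_step s A hA k (fun i hi => ih i (by omega))
      rw [← cstar_rec s hs k, norm_mul] at g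
      have l := pow_sub_lower s hs (k + 1)
      push_cast at l
      rw [← add_assoc] at l
      have b := hM (k + 1) (by omega)
      have p : (0 : ℝ) < (5 / 3 : ℝ) ^ (⌈‖s‖⌉₊ + (k + 1)) := by positivity
      have q : (5 / 3 : ℝ) ^ (⌈‖s‖⌉₊ + (k + 1)) * ‖cstarC 2 s (k + 1)‖ ≤
          (5 / 3 : ℝ) ^ (⌈‖s‖⌉₊ + (k + 1)) * (A * (3 / 2) ^ (k + 1)) := by
        refine (mul_le_mul_of_nonneg_right (b.trans l) (norm_nonneg _)).trans (g.trans (le_of_eq (by ring)))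
      exact le_of_mul_le_mul_left q p

theorem dco_growth (s : ℂ) (hs : 0 < s.re) :
    ∃ A : ℝ, 0 ≤ A ∧ ∀ m, ‖dco s m‖ ≤ A * (3 / 2 : ℝ) ^ m := by
  obtain ⟨A, hA, h⟩ := growth s hs
  refine ⟨A, hA, fun m => le_trans ?_ (h m)⟩
  have hn : ‖s‖ ≤ ‖s + m‖ := by
    rw [Complex.norm_def, Complex.norm_def]
    apply Real.sqrt_le_sqrt
    simp only [Complex.normSq_apply, Complex.add_re, Complex.natCast_re, Complex.add_im, Complex.natCast_im, add_zero]
    have : (0 : ℝ) ≤ m := by positivity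
    nlinarith
  have h0 : 0 < ‖s + m‖ := norm_pos_iff.2 (s_add_ne s hs m)
  simp only [dco, norm_mul, norm_div, norm_pow, norm_neg, norm_one, one_pow, one_mul]
  rw [div_le_iff₀ h0]
  nlinarith [norm_nonneg (cstarC 2 s m)]

theorem npow_norm (s : ℂ) (n m : ℕ) (hn : 1 ≤ n) :
    ‖(n : ℂ) ^ (-(s + (m : ℂ)))‖ = (n : ℝ) ^ (-s.re) * (1 / (n : ℝ)) ^ m := by
  have hn' : (0 : ℝ) < n := by exact_mod_cast hn
  rw [Complex.norm_natCast_cpow_of_pos (by omega)]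
  simp only [Complex.neg_re, Complex.add_re, Complex.natCast_re, neg_add]
  rw [Real.rpow_add hn', Real.rpow_neg hn'.le m, Real.rpow_natCast]
  simp

theorem npow_norm_le (s : ℂ) (hs : 0 < s.re) (n m : ℕ) (hn : 1 ≤ n) :
    ‖(n : ℂ) ^ (-(s + (m : ℂ)))‖ ≤ (1 / (n : ℝ)) ^ m := by
  rw [npow_norm s n m hn]
  have : (n : ℝ) ^ (-s.re) ≤ 1 := Real.rpow_le_one_of_one_le_of_nonpos (by exact_mod_cast hn) (by linarith)
  have h : 0 ≤ (1 / (n : ℝ)) ^ m := by positivity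
  nlinarith

theorem term_summable (s : ℂ) (hs : 0 < s.re) (n : ℕ) (hn : 2 ≤ n) :
    Summable (fun m : ℕ => ‖dco s m * (n : ℂ) ^ (-(s + (m : ℂ)))‖) := by
  obtain ⟨A, hA, h⟩ := dco_growth s hs
  refine Summable.of_nonneg_of_le (fun _ => norm_nonneg _) (f := fun m => A * (3 / 4 : ℝ) ^ m) (fun m => ?_)
    ((summable_geometric_of_lt_one (by norm_num) (by norm_num)).mul_left _)
  rw [norm_mul]
  have h1 := npow_norm_le s hs n m (by omega)
  have h2 : (1 / (n : ℝ)) ^ m ≤ (1 / 2) ^ m := by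
    have : (2 : ℝ) ≤ n := by exact_mod_cast hn
    gcongr
  refine (mul_le_mul (h m) (h1.trans h2) (norm_nonneg _) (by positivity)).trans (le_of_eq ?_)
  rw [mul_assoc, ← mul_pow]; norm_num

/-- The function given by the series -/
noncomputable def gfun (s : ℂ) (n : ℕ) : ℂ := ∑' m : ℕ, dco s m * (n : ℂ) ^ (-(s + (m : ℂ)))

theorem dco_zero (s : ℂ) (hs : 0 < s.re) : dco s 0 = 1 := by
  have := s_add_ne s hs 0
  simp at this
  simp [dco, cstarC, this]

theorem gfun_approx (s : ℂ) (hs : 0 < s.re) : ∃ B : ℝ, 0 ≤ B ∧ ∀ n : ℕ, 2 ≤ n →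
    ‖gfun s n - (n : ℂ) ^ (-s)‖ ≤ B * ((n : ℝ) ^ (-s.re) * (1 / (n : ℝ))) := by
  obtain ⟨A, hA, h⟩ := dco_growth s hs
  refine ⟨A * (3 / 2) * 4, by positivity, fun n hn => ?_⟩
  have hsum := term_summable s hs n hn
  have e := hsum.of_norm.tsum_eq_zero_add
  rw [gfun, e, dco_zero s hs]
  simp only [Nat.cast_zero, add_zero, one_mul, add_sub_cancel_left]
  have hn2 : (2 : ℝ) ≤ n := by exact_mod_cast hn
  set c := ((n : ℝ) ^ (-s.re) * (1 / (n : ℝ)))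
  have hc : 0 ≤ c := by positivity
  have hg := (hasSum_geometric_of_lt_one (r := (3 / 4 : ℝ)) (by norm_num) (by norm_num)).mul_left (A * (3 / 2) * c)
  have := tsum_of_norm_bounded hg (f := fun b : ℕ => dco s (b + 1) * (n : ℂ) ^ (-(s + ((b + 1 : ℕ) : ℂ)))) (fun m => by
    rw [norm_mul, npow_norm s n _ (by omega)]
    have h2 : (1 / (n : ℝ)) ^ m ≤ (1 / 2) ^ m := by gcongr
    have h3 : (n : ℝ) ^ (-s.re) * (1 / (n : ℝ)) ^ (m + 1) ≤ c * (1 / 2) ^ m := by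
      rw [pow_succ, show (n : ℝ) ^ (-s.re) * ((1 / (n : ℝ)) ^ m * (1 / (n : ℝ))) = c * (1 / (n : ℝ)) ^ m by simp only [c]; ring]
      gcongr
    refine (mul_le_mul (h _) h3 (by positivity) (by positivity)).trans (le_of_eq ?_)
    rw [show (3 / 4 : ℝ) ^ m = (3 / 2) ^ m * (1 / 2) ^ m by rw [← mul_pow]; norm_num]
    ring)
  refine this.trans (le_of_eq ?_)
  norm_num
  ring

theorem U_preconn : IsPreconnected {s : ℂ | 0 < s.re ∧ s ≠ 1} := by
  have hA : IsPreconnected ({s : ℂ | 0 < s.re} ∩ {s : ℂ | 0 < s.im}) :=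
    ((convex_halfSpace_re_gt 0).inter (convex_halfSpace_im_gt 0)).isPreconnected
  have hB : IsPreconnected ({s : ℂ | 0 < s.re} ∩ {s : ℂ | s.im < 0}) :=
    ((convex_halfSpace_re_gt 0).inter (convex_halfSpace_im_lt 0)).isPreconnected
  have hC : IsPreconnected ({s : ℂ | 0 < s.re} ∩ {s : ℂ | s.re < 1}) :=
    ((convex_halfSpace_re_gt 0).inter (convex_halfSpace_re_lt 1)).isPreconnected
  have hD : IsPreconnected {s : ℂ | 1 < s.re} := (convex_halfSpace_re_gt 1).isPreconnected
  have h1 := IsPreconnected.union (⟨1 / 2, 1⟩ : ℂ) (by norm_num) (by norm_num) hA hC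
  have h2 := IsPreconnected.union (⟨1 / 2, -1⟩ : ℂ) (by norm_num) (by norm_num) h1 hB
  have h3 := IsPreconnected.union (⟨2, 1⟩ : ℂ) (by norm_num) (by norm_num) h2 hD
  convert h3 using 1
  ext s
  simp only [Set.mem_ofPred_eq, Set.mem_union, Set.mem_inter_iff, ne_eq, Complex.ext_iff, Complex.one_re, Complex.one_im]
  constructor
  · rintro ⟨h, h'⟩
    rcases lt_trichotomy s.im 0 with a | a | a
    · exact Or.inl (Or.inr ⟨h, a⟩)
    · rcases lt_trichotomy s.re 1 with b | b | b
      · exact Or.inl (Or.inl (Or.inr ⟨h, b⟩))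
      · exact absurd ⟨b, a⟩ h'
      · exact Or.inr b
    · exact Or.inl (Or.inl (Or.inl ⟨h, a⟩))
  · rintro (((⟨h, a⟩ | ⟨h, a⟩) | ⟨h, a⟩) | a)
    · exact ⟨h, fun h' => by linarith [h'.2]⟩
    · exact ⟨h, fun h' => by linarith [h'.1]⟩
    · exact ⟨h, fun h' => by linarith [h'.2]⟩
    · exact ⟨by linarith, fun h' => by linarith [h'.1]⟩

/-- paired term of the eta series -/
noncomputable def eterm (k : ℕ) (s : ℂ) : ℂ :=
  ((2 * k + 1 : ℕ) : ℂ) ^ (-s) - ((2 * k + 2 : ℕ) : ℂ) ^ (-s)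

theorem eterm_diff (k : ℕ) : Differentiable ℂ (eterm k) := by
  intro s
  unfold eterm
  refine DifferentiableAt.sub ?_ ?_
  · exact DifferentiableAt.const_cpow (by fun_prop) (Or.inl (Nat.cast_ne_zero.2 (by omega)))
  · exact DifferentiableAt.const_cpow (by fun_prop) (Or.inl (Nat.cast_ne_zero.2 (by omega)))

theorem eterm_bound (k : ℕ) (s : ℂ) (hs : 0 < s.re) :
    ‖eterm k s‖ ≤ ‖s‖ * ((2 * k + 1 : ℕ) : ℝ) ^ (-s.re - 1) := by
  set a : ℝ := ((2 * k + 1 : ℕ) : ℝ) with ha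
  have ha0 : 0 < a := by rw [ha]; exact_mod_cast Nat.succ_pos _
  have hd : ∀ x ∈ Set.Icc a (a + 1), HasDerivWithinAt (fun x : ℝ => (x : ℂ) ^ (-s)) ((-s) * (x : ℂ) ^ (-s - 1)) (Set.Icc a (a + 1)) x := by
    intro x hx
    have hx0 : 0 < x := lt_of_lt_of_le ha0 hx.1
    by_cases h0 : s = 0
    · simp [h0] at hs
    exact (hasDerivAt_ofReal_cpow_const hx0.ne' (neg_ne_zero.2 h0)).hasDerivWithinAt
  have hb : ∀ x ∈ Set.Icc a (a + 1), ‖(-s) * (x : ℂ) ^ (-s - 1)‖ ≤ ‖s‖ * a ^ (-s.re - 1) := by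
    intro x hx
    have hx0 : 0 < x := lt_of_lt_of_le ha0 hx.1
    rw [norm_mul, norm_neg, Complex.norm_cpow_eq_rpow_re_of_pos hx0]
    refine mul_le_mul_of_nonneg_left ?_ (norm_nonneg _)
    simp only [Complex.sub_re, Complex.neg_re, Complex.one_re]
    exact Real.rpow_le_rpow_of_nonpos ha0 hx.1 (by linarith)
  have := (convex_Icc a (a + 1)).norm_image_sub_le_of_norm_hasDerivWithin_le hd hb
    (x := a + 1) (y := a) (by simp) (by simp)
  simp only [eterm]
  have e1 : ((2 * k + 1 : ℕ) : ℂ) = (a : ℂ) := by simp [ha]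
  have e2 : ((2 * k + 2 : ℕ) : ℂ) = ((a + 1 : ℝ) : ℂ) := by simp [ha]; ring
  rw [e1, e2]
  simpa using this

theorem odd_summable (σ : ℝ) (hσ : 0 < σ) : Summable fun k : ℕ => ((2 * k + 1 : ℕ) : ℝ) ^ (-σ - 1) := by
  have h : Summable fun n : ℕ => (n : ℝ) ^ (-σ - 1) := Real.summable_nat_rpow.2 (by linarith)
  exact h.comp_injective (i := fun k => 2 * k + 1) (fun a b hab => by simpa using hab)

theorem eta_diff : DifferentiableOn ℂ (fun s => ∑' k, eterm k s) {s : ℂ | 0 < s.re} := by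
  intro s hs
  have hs : 0 < s.re := hs
  set V : Set ℂ := {w : ℂ | s.re / 2 < w.re} ∩ Metric.ball 0 (‖s‖ + 1)
  have hV : IsOpen V := (isOpen_lt continuous_const Complex.continuous_re).inter Metric.isOpen_ball
  have hsV : s ∈ V := ⟨by simp; linarith, by simp⟩
  have := Complex.differentiableOn_tsum_of_summable_norm (F := eterm) (U := V)
    (u := fun k => (‖s‖ + 1) * ((2 * k + 1 : ℕ) : ℝ) ^ (-(s.re / 2) - 1))
    ((odd_summable _ (by linarith)).mul_left _) (fun i => (eterm_diff i).differentiableOn) hV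
    (fun i w hw => by
      have h1 : s.re / 2 < w.re := hw.1
      have h2 : ‖w‖ < ‖s‖ + 1 := by simpa using hw.2
      refine (eterm_bound i w (by linarith)).trans ?_
      refine mul_le_mul h2.le ?_ (by positivity) (by positivity)
      refine Real.rpow_le_rpow_of_exponent_le (by exact_mod_cast Nat.succ_pos _) (by linarith))
  exact (this.differentiableAt (hV.mem_nhds hsV)).differentiableWithinAt

theorem eterm_summable (s : ℂ) (hs : 0 < s.re) : Summable fun k => eterm k s :=
  Summable.of_norm_bounded ((odd_summable s.re hs).mul_left ‖s‖) (fun k => eterm_bound k s hs)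

theorem two_cpow_ne (s : ℂ) : (2 : ℂ) ^ s ≠ 0 := by simp [Complex.cpow_eq_zero_iff]

theorem eta_partial (s : ℂ) (N : ℕ) : ∑ k ∈ Finset.range N, eterm k s =
    ((2 : ℂ) ^ s - 2) / (2 : ℂ) ^ s * ∑ k ∈ Finset.range N, ((k + 1 : ℕ) : ℂ) ^ (-s)
      + ∑ k ∈ Finset.Ico N (2 * N), ((k + 1 : ℕ) : ℂ) ^ (-s) := by
  have h1 : ∑ k ∈ Finset.range (2 * N), ((k + 1 : ℕ) : ℂ) ^ (-s) =
     ∑ k ∈ Finset.range N, (((2 * k + 1 : ℕ) : ℂ) ^ (-s) + ((2 * k + 2 : ℕ) : ℂ) ^ (-s)) := by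
    induction N with
    | zero => simp
    | succ n ih =>
      rw [show 2 * (n + 1) = 2 * n + 1 + 1 by ring, Finset.sum_range_succ, Finset.sum_range_succ, ih, Finset.sum_range_succ]
      ring
  have h2 : ∀ k : ℕ, ((2 * k + 2 : ℕ) : ℂ) ^ (-s) = 1 / (2 : ℂ) ^ s * ((k + 1 : ℕ) : ℂ) ^ (-s) := by
    intro k
    rw [show 2 * k + 2 = 2 * (k + 1) by ring, Nat.cast_mul, Complex.natCast_mul_natCast_cpow, Complex.cpow_neg _ s]
    simp
  rw [Finset.sum_Ico_eq_sub _ (by omega), h1, Finset.sum_add_distrib]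
  simp only [eterm, Finset.sum_sub_distrib, h2, ← Finset.mul_sum]
  field_simp [two_cpow_ne s]
  ring

theorem eta_eq_of_one_lt (s : ℂ) (hs : 1 < s.re) :
    ((2 : ℂ) ^ s - 2) / (2 : ℂ) ^ s * riemannZeta s = ∑' k, eterm k s := by
  have hz := zeta_eq_tsum_one_div_nat_add_one_cpow hs
  have hsum : Summable fun n : ℕ => ((n + 1 : ℕ) : ℂ) ^ (-s) := by
    have h := (Complex.summable_one_div_nat_cpow (p := s)).2 hs
    have := (summable_nat_add_iff 1).2 h
    simpa [Complex.cpow_neg] using this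
  have hz' : HasSum (fun n : ℕ => ((n + 1 : ℕ) : ℂ) ^ (-s)) (riemannZeta s) := by
    rw [hz]
    convert hsum.hasSum using 1
    refine tsum_congr fun n => ?_
    simp [Complex.cpow_neg]
  have t1 := hz'.tendsto_sum_nat
  have t2 := t1.comp (Filter.tendsto_id.const_mul_atTop' (show 0 < 2 by norm_num) : Filter.Tendsto (fun n : ℕ => 2 * n) Filter.atTop Filter.atTop)
  have t3 := (eterm_summable s (by linarith)).hasSum.tendsto_sum_nat
  simp only [eta_partial] at t3
  have t4 := (t1.const_mul (((2 : ℂ) ^ s - 2) / (2 : ℂ) ^ s)).add (t2.sub t1)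
  rw [sub_self, add_zero] at t4
  refine tendsto_nhds_unique t4 (t3.congr fun N => ?_)
  rw [Finset.sum_Ico_eq_sub _ (by omega)]
  rfl

theorem eta_eq (s : ℂ) (hs : 0 < s.re) (hs1 : s ≠ 1) :
    ((2 : ℂ) ^ s - 2) / (2 : ℂ) ^ s * riemannZeta s = ∑' k, eterm k s := by
  have hU : IsOpen {s : ℂ | 0 < s.re ∧ s ≠ 1} :=
    (isOpen_lt continuous_const Complex.continuous_re).inter isOpen_ne
  have h1 : AnalyticOnNhd ℂ (fun s : ℂ => ((2 : ℂ) ^ s - 2) / (2 : ℂ) ^ s * riemannZeta s) {s : ℂ | 0 < s.re ∧ s ≠ 1} := by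
    refine DifferentiableOn.analyticOnNhd (fun z hz => DifferentiableAt.differentiableWithinAt ?_) hU
    have hp : DifferentiableAt ℂ (fun s : ℂ => (2 : ℂ) ^ s) z :=
      DifferentiableAt.const_cpow (by fun_prop) (Or.inl two_ne_zero)
    exact ((hp.sub_const 2).div hp (two_cpow_ne z)).mul (differentiableAt_riemannZeta hz.2)
  have h2 : AnalyticOnNhd ℂ (fun s => ∑' k, eterm k s) {s : ℂ | 0 < s.re ∧ s ≠ 1} :=
    (eta_diff.mono fun z hz => hz.1).analyticOnNhd hU
  have := h1.eqOn_of_preconnected_of_eventuallyEq h2 U_preconn (z₀ := 2) (by norm_num)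
    (Filter.eventuallyEq_of_mem ((isOpen_lt continuous_const Complex.continuous_re).mem_nhds
      (show (1 : ℝ) < (2 : ℂ).re by norm_num)) fun z hz => eta_eq_of_one_lt z hz)
  exact this ⟨hs, hs1⟩

theorem eta_tendsto (s : ℂ) (hs : 0 < s.re) (hs1 : s ≠ 1) :
    Filter.Tendsto (fun N => ∑ k ∈ Finset.range N, eterm k s) Filter.atTop
      (nhds (((2 : ℂ) ^ s - 2) / (2 : ℂ) ^ s * riemannZeta s)) := by
  rw [eta_eq s hs hs1]
  exact (eterm_summable s hs).hasSum.tendsto_sum_nat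

theorem hasSum_antidiag (F : ℕ × ℕ → ℂ) (hF : Summable F) :
    HasSum (fun M => ∑ p ∈ Finset.HasAntidiagonal.antidiagonal M, F p) (∑' p, F p) := by
  have h := (Finset.HasAntidiagonal.sigmaAntidiagonalEquivProd (A := ℕ)).hasSum_iff.2 hF.hasSum
  refine h.sigma fun M => ?_
  have := hasSum_fintype (fun p : {x // x ∈ Finset.HasAntidiagonal.antidiagonal M} => F p)
  rw [Finset.sum_coe_sort (Finset.HasAntidiagonal.antidiagonal M) F] at this
  exact this

/-- double family -/
noncomputable def Fdbl (s : ℂ) (y : ℕ) (p : ℕ × ℕ) : ℂ :=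
  dco s p.1 * (y : ℂ) ^ (-(s + (p.1 : ℂ))) * (((-1) ^ p.2 * rb (s + p.1) p.2) * (1 / (y : ℂ)) ^ p.2)

theorem Fdbl_summable (s : ℂ) (hs : 0 < s.re) (y : ℕ) (hy : 4 ≤ y) : Summable (Fdbl s y) := by
  obtain ⟨A, hA, h⟩ := dco_growth s hs
  set K := ⌈‖s‖⌉₊ with hK
  have hy' : (4 : ℝ) ≤ y := by exact_mod_cast hy
  set z : ℝ := 1 / (y : ℝ) with hz
  have hz0 : 0 ≤ z := by positivity
  have hz4 : z ≤ 1 / 4 := by rw [hz]; gcongr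
  have hzn : ‖z‖ < 1 := by rw [Real.norm_of_nonneg hz0]; linarith
  refine Summable.of_norm_bounded
    (g := fun p : ℕ × ℕ => (A * (3 / 2 : ℝ) ^ p.1 * z ^ p.1) * (((p.2 + (K + p.1)).choose (K + p.1) : ℝ) * z ^ p.2)) ?_ ?_
  · have hpos : ∀ p : ℕ × ℕ, 0 ≤ (A * (3 / 2 : ℝ) ^ p.1 * z ^ p.1) * (((p.2 + (K + p.1)).choose (K + p.1) : ℝ) * z ^ p.2) :=
      fun p => by positivity
    rw [summable_prod_of_nonneg hpos]
    constructor
    · intro m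
      exact (summable_choose_mul_geometric_of_norm_lt_one (K + m) hzn).mul_left (A * (3 / 2 : ℝ) ^ m * z ^ m)
    · simp only [tsum_mul_left, tsum_choose_mul_geometric_of_norm_lt_one _ hzn]
      have hr : (3 / 2 * z / (1 - z)) < 1 := by
        rw [div_lt_one (by linarith)]; linarith
      have hr0 : 0 ≤ (3 / 2 * z / (1 - z)) := div_nonneg (by positivity) (by linarith)
      refine ((summable_geometric_of_lt_one hr0 hr).mul_left (A / (1 - z) ^ (K + 1))).congr fun m => ?_
      have : (1 - z) ≠ 0 := by linarith
      rw [div_pow, mul_pow, show K + m + 1 = (K + 1) + m by ring, pow_add _ (K + 1) m]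
      field_simp
  · rintro ⟨m, j⟩
    simp only [Fdbl, norm_mul, norm_pow, norm_neg, norm_one, one_pow, one_mul, norm_div, Complex.norm_natCast]
    have h1 := npow_norm_le s hs y m (by omega)
    have h2 := rb_bound s m j
    refine mul_le_mul (mul_le_mul (h m) h1 (norm_nonneg _) (by positivity)) ?_ (by positivity) (by positivity)
    exact mul_le_mul_of_nonneg_right h2 (by positivity)

theorem gfun_hasSum (s : ℂ) (hs : 0 < s.re) (n : ℕ) (hn : 2 ≤ n) :
    HasSum (fun m : ℕ => dco s m * (n : ℂ) ^ (-(s + (m : ℂ)))) (gfun s n) :=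
  (term_summable s hs n hn).of_norm.hasSum

theorem gfun_succ (s : ℂ) (hs : 0 < s.re) (y : ℕ) (hy : 4 ≤ y) :
    gfun s (y + 1) = ∑' p, Fdbl s y p := by
  have hy' : (4 : ℝ) ≤ y := by exact_mod_cast hy
  rw [(Fdbl_summable s hs y hy).tsum_prod, gfun]
  refine tsum_congr fun m => ?_
  simp only [Fdbl]
  rw [tsum_mul_left, (binom_hasSum (s + m) (1 / (y : ℂ)) ?_).tsum_eq, mul_assoc]
  · congr 1
    have e := Complex.mul_cpow_ofReal_nonneg (a := (y : ℝ)) (b := 1 + 1 / (y : ℝ)) (by positivity) (by positivity) (-(s + m))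
    have e2 : ((y + 1 : ℕ) : ℂ) = (((y : ℝ) : ℂ) * ((1 + 1 / (y : ℝ) : ℝ) : ℂ)) := by
      have : (y : ℂ) ≠ 0 := Nat.cast_ne_zero.2 (by omega)
      push_cast
      field_simp
    rw [e2, e]
    push_cast
    rfl
  · rw [norm_div, norm_one, Complex.norm_natCast, div_lt_one (by linarith)]
    linarith

theorem fun_eq (s : ℂ) (hs : 0 < s.re) (x : ℕ) (hx : 2 ≤ x) :
    gfun s x - gfun s (2 * x) - gfun s (2 * x + 1) = ((2 : ℂ) ^ s - 2) / (2 : ℂ) ^ s * (x : ℂ) ^ (-s) := by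
  have h1 := hasSum_antidiag _ (Fdbl_summable s hs (2 * x) (by omega))
  rw [← gfun_succ s hs (2 * x) (by omega)] at h1
  have h2 := (gfun_hasSum s hs x hx).sub (gfun_hasSum s hs (2 * x) (by omega))
  have hxx : (x : ℂ) ≠ 0 := Nat.cast_ne_zero.2 (by omega)
  have hy0 : ((2 * x : ℕ) : ℂ) ≠ 0 := Nat.cast_ne_zero.2 (by omega)
  have mulpow : ∀ w : ℂ, ((2 * x : ℕ) : ℂ) ^ (-w) * (2 : ℂ) ^ w = (x : ℂ) ^ (-w) := by
    intro w
    rw [Nat.cast_mul, Complex.natCast_mul_natCast_cpow, Complex.cpow_neg _ w]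
    have : ((2 : ℕ) : ℂ) ^ w ≠ 0 := by simp [Complex.cpow_eq_zero_iff]
    push_cast at *
    field_simp
  have h3 := (h2.sub h1)
  have h4 : HasSum (fun M : ℕ => if M = 0 then ((x : ℂ) ^ (-s) - 2 * ((2 * x : ℕ) : ℂ) ^ (-s)) else 0)
      ((x : ℂ) ^ (-s) - 2 * ((2 * x : ℕ) : ℂ) ^ (-s)) := hasSum_ite_eq 0 _
  have h5 : ∀ M, ∑ p ∈ Finset.HasAntidiagonal.antidiagonal M, Fdbl s (2 * x) p =
     ((2 * x : ℕ) : ℂ) ^ (-(s + (M : ℂ))) * ∑ p ∈ Finset.HasAntidiagonal.antidiagonal M, dco s p.1 * ((-1) ^ p.2 * rb (s + p.1) p.2) := by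
    intro M
    rw [Finset.mul_sum]
    refine Finset.sum_congr rfl fun p hp => ?_
    have hp : p.1 + p.2 = M := by simpa using hp
    have : ((2 * x : ℕ) : ℂ) ^ (-(s + (M : ℂ))) = ((2 * x : ℕ) : ℂ) ^ (-(s + (p.1 : ℂ))) * (1 / ((2 * x : ℕ) : ℂ)) ^ p.2 := by
      rw [← hp, show (-(s + ((p.1 + p.2 : ℕ) : ℂ))) = -(s + (p.1 : ℂ)) + -(p.2 : ℂ) by push_cast; ring,
        Complex.cpow_add _ _ hy0, Complex.cpow_neg _ (p.2 : ℂ), Complex.cpow_natCast, one_div, inv_pow]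
    rw [this, Fdbl]
    ring
  have key := h3.unique (h4.congr_fun ?_)
  · rw [key]
    have := mulpow s
    rw [← this]
    have := two_cpow_ne s
    field_simp
  · intro M
    rw [h5]
    rcases M with _ | m
    · simp [dco_zero s hs, rb]
      ring
    · rw [dco_rec s hs m]
      have := mulpow (s + ((m + 1 : ℕ) : ℂ))
      rw [← this]
      simp only [Nat.succ_ne_zero, if_false]
      push_cast
      simp only [← add_assoc]
      ring

/-- right-hand side for blocks -/
noncomputable def Tfun (s : ℂ) (N : ℕ) : ℂ :=
  ((2 : ℂ) ^ s - 2) / (2 : ℂ) ^ s * ∑ n ∈ Finset.Ico 1 N, (n : ℂ) ^ (-s) + ∑ n ∈ Finset.Ico N (2 * N), gfun s n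

theorem block_double (f : ℕ → ℂ) (N M : ℕ) (h : N ≤ M) : ∑ n ∈ Finset.Ico (2 * N) (2 * M), f n =
    ∑ n ∈ Finset.Ico N M, (f (2 * n) + f (2 * n + 1)) := by
  induction M, h using Nat.le_induction with
  | base => simp
  | succ k hk ih =>
    rw [show 2 * (k + 1) = 2 * k + 1 + 1 by ring, Finset.sum_Ico_succ_top (by omega), Finset.sum_Ico_succ_top (by omega), ih,
      Finset.sum_Ico_succ_top hk]
    ring

theorem Tfun_double (s : ℂ) (hs : 0 < s.re) (N : ℕ) (hN : 2 ≤ N) : Tfun s (2 * N) = Tfun s N := by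
  have e : ∑ n ∈ Finset.Ico N (2 * N), (gfun s n - gfun s (2 * n) - gfun s (2 * n + 1)) =
      ((2 : ℂ) ^ s - 2) / (2 : ℂ) ^ s * ∑ n ∈ Finset.Ico N (2 * N), (n : ℂ) ^ (-s) := by
    rw [Finset.mul_sum]
    refine Finset.sum_congr rfl fun n hn => fun_eq s hs n ?_
    have := (Finset.mem_Ico.1 hn).1
    omega
  simp only [sub_sub] at e
  rw [Finset.sum_sub_distrib] at e
  rw [Tfun, Tfun, block_double _ N (2 * N) (by omega), ← Finset.sum_Ico_consecutive _ (show 1 ≤ N by omega) (show N ≤ 2 * N by omega)]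
  linear_combination -e

theorem Tfun_approx (s : ℂ) (hs : 0 < s.re) : ∃ B : ℝ, ∀ N : ℕ, 2 ≤ N →
    ‖Tfun s N - ((∑ k ∈ Finset.range N, eterm k s) - ((2 : ℂ) ^ s - 2) / (2 : ℂ) ^ s * (N : ℂ) ^ (-s)
      - ((2 * N : ℕ) : ℂ) ^ (-s) + (N : ℂ) ^ (-s))‖ ≤ B * (N : ℝ) ^ (-s.re) := by
  obtain ⟨B, hB, h⟩ := gfun_approx s hs
  refine ⟨B, fun N hN => ?_⟩
  have e1 : ∑ k ∈ Finset.range N, ((k + 1 : ℕ) : ℂ) ^ (-s) = ∑ n ∈ Finset.Ico 1 N, (n : ℂ) ^ (-s) + (N : ℂ) ^ (-s) := by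
    rw [Finset.range_eq_Ico, Finset.sum_Ico_add' (fun n : ℕ => (n : ℂ) ^ (-s)) 0 N 1, Finset.sum_Ico_succ_top (by omega)]
  have e2 : ∑ k ∈ Finset.Ico N (2 * N), ((k + 1 : ℕ) : ℂ) ^ (-s) =
      ∑ n ∈ Finset.Ico N (2 * N), (n : ℂ) ^ (-s) + ((2 * N : ℕ) : ℂ) ^ (-s) - (N : ℂ) ^ (-s) := by
    rw [Finset.sum_Ico_add' (fun n : ℕ => (n : ℂ) ^ (-s)) N (2 * N) 1, Finset.sum_Ico_succ_top (by omega),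
      Finset.sum_eq_sum_Ico_succ_bot (show N < 2 * N by omega)]
    ring
  rw [eta_partial, e1, e2, Tfun]
  have e3 : ∀ a b c d x y : ℂ, a * b + c - (a * (b + x) + (d + y - x) - a * x - y + x) = c - d := by
    intros; ring
  rw [e3, ← Finset.sum_sub_distrib]
  have hN0 : (0 : ℝ) < N := by exact_mod_cast (by omega : 0 < N)
  have := norm_sum_le_of_le (Finset.Ico N (2 * N)) (f := fun n => gfun s n - (n : ℂ) ^ (-s))
    (n := fun _ => B * ((N : ℝ) ^ (-s.re) * (1 / (N : ℝ)))) (fun n hn => by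
      have hn1 := (Finset.mem_Ico.1 hn).1
      refine (h n (by omega)).trans ?_
      have hn2 : (N : ℝ) ≤ n := by exact_mod_cast hn1
      have : (n : ℝ) ^ (-s.re) ≤ (N : ℝ) ^ (-s.re) := Real.rpow_le_rpow_of_nonpos hN0 hn2 (by linarith)
      gcongr)
  refine this.trans (le_of_eq ?_)
  simp only [Finset.sum_const, Nat.card_Ico, show 2 * N - N = N by omega, nsmul_eq_mul]
  field_simp

theorem ncpow_tendsto (s : ℂ) (hs : 0 < s.re) :
    Filter.Tendsto (fun N : ℕ => (N : ℂ) ^ (-s)) Filter.atTop (nhds 0) := by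
  rw [tendsto_zero_iff_norm_tendsto_zero]
  have := (tendsto_rpow_neg_atTop hs).comp tendsto_natCast_atTop_atTop
  refine this.congr' ?_
  filter_upwards [Filter.eventually_gt_atTop 0] with N hN
  rw [Complex.norm_natCast_cpow_of_pos hN]
  simp

theorem Tfun_tendsto (s : ℂ) (hs : 0 < s.re) (hs1 : s ≠ 1) :
    Filter.Tendsto (Tfun s) Filter.atTop (nhds (((2 : ℂ) ^ s - 2) / (2 : ℂ) ^ s * riemannZeta s)) := by
  obtain ⟨B, hB⟩ := Tfun_approx s hs
  have t0 := ncpow_tendsto s hs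
  have t2 := t0.comp (Filter.tendsto_id.const_mul_atTop' (show 0 < 2 by norm_num) : Filter.Tendsto (fun n : ℕ => 2 * n) Filter.atTop Filter.atTop)
  have t := (((eta_tendsto s hs hs1).sub (t0.const_mul (((2 : ℂ) ^ s - 2) / (2 : ℂ) ^ s))).sub t2).add t0
  have t3 : Filter.Tendsto (fun N : ℕ => B * (N : ℝ) ^ (-s.re)) Filter.atTop (nhds (B * 0)) :=
    ((tendsto_rpow_neg_atTop hs).comp tendsto_natCast_atTop_atTop).const_mul B
  rw [mul_zero] at t3
  have d := squeeze_zero_norm' (Filter.eventually_atTop.2 ⟨2, hB⟩) t3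
  have := d.add t
  simp only [mul_zero, sub_zero, add_zero, zero_add] at this
  refine this.congr fun N => ?_
  simp only [Function.comp]
  ring

theorem Tfun_eq (s : ℂ) (hs : 0 < s.re) (hs1 : s ≠ 1) (L : ℕ) (hL : 1 ≤ L) :
    Tfun s (2 ^ L) = ((2 : ℂ) ^ s - 2) / (2 : ℂ) ^ s * riemannZeta s := by
  have hc : ∀ k, Tfun s (2 ^ (L + k)) = Tfun s (2 ^ L) := by
    intro k
    induction k with
    | zero => rfl
    | succ k ih =>
      rw [← ih, ← add_assoc, pow_succ, mul_comm, Tfun_double s hs]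
      calc 2 = 2 ^ 1 := by norm_num
        _ ≤ 2 ^ (L + k) := Nat.pow_le_pow_right (by norm_num) (by omega)
  have ht : Filter.Tendsto (fun k => 2 ^ (L + k)) Filter.atTop (Filter.atTop : Filter ℕ) :=
    (tendsto_pow_atTop_atTop_of_one_lt (by norm_num)).comp (Filter.tendsto_atTop_mono (fun k => Nat.le_add_left k L) Filter.tendsto_id)
  have := (Tfun_tendsto s hs hs1).comp ht
  refine tendsto_nhds_unique (tendsto_const_nhds.congr fun k => ?_) this
  exact (hc k).symm

/-- Theorem 1 (main formula, b = 2): for Re s > 0, s ≠ 1 and ℓ ≥ 2, the series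
∑ₘ (−1)^m (s c*_{m,2}(s)/(s+m)) ∑_{2^{ℓ−1} ≤ n < 2^ℓ} n^{−s−m} converges absolutely and
((2^s−2)/2^s) ζ(s) = ((2^s−2)/2^s) ∑_{0<n<2^{ℓ−1}} n^{−s} + that series. -/
theorem main_formula_b2 (s : ℂ) (hs : 0 < s.re) (hs1 : s ≠ 1) (ℓ : ℕ) (hℓ : 2 ≤ ℓ) :
    Summable (fun m : ℕ => ‖(-1 : ℂ) ^ m * (s * cstarC 2 s m / (s + (m : ℂ))) *
        ∑ n ∈ Finset.Ico (α := ℕ) (2 ^ (ℓ - 1)) (2 ^ ℓ), (n : ℂ) ^ (-(s + (m : ℂ)))‖) ∧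
    ((2 : ℂ) ^ s - 2) / (2 : ℂ) ^ s * riemannZeta s =
      ((2 : ℂ) ^ s - 2) / (2 : ℂ) ^ s * ∑ n ∈ Finset.Ico (α := ℕ) 1 (2 ^ (ℓ - 1)), (n : ℂ) ^ (-s) +
      ∑' m : ℕ, (-1 : ℂ) ^ m * (s * cstarC 2 s m / (s + (m : ℂ))) *
        ∑ n ∈ Finset.Ico (α := ℕ) (2 ^ (ℓ - 1)) (2 ^ ℓ), (n : ℂ) ^ (-(s + (m : ℂ))) := by
  have hp : 2 ^ ℓ = 2 * 2 ^ (ℓ - 1) := by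
    rw [← pow_succ']; congr 1; omega
  have h2 : 2 ≤ 2 ^ (ℓ - 1) := by
    calc 2 = 2 ^ 1 := by norm_num
      _ ≤ 2 ^ (ℓ - 1) := Nat.pow_le_pow_right (by norm_num) (by omega)
  have hmem : ∀ n ∈ Finset.Ico (2 ^ (ℓ - 1)) (2 ^ ℓ), 2 ≤ n := fun n hn =>
    h2.trans (Finset.mem_Ico.1 hn).1
  constructor
  · refine Summable.of_nonneg_of_le (fun _ => norm_nonneg _)
      (f := fun m : ℕ => ∑ n ∈ Finset.Ico (α := ℕ) (2 ^ (ℓ - 1)) (2 ^ ℓ), ‖dco s m * (n : ℂ) ^ (-(s + (m : ℂ)))‖) (fun m => ?_)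
      (summable_sum fun n hn => term_summable s hs n (hmem n hn))
    rw [Finset.mul_sum]
    exact norm_sum_le _ _
  · have h := Tfun_eq s hs hs1 (ℓ - 1) (by omega)
    rw [Tfun, ← hp] at h
    rw [← h]
    congr 1
    have := hasSum_sum (s := Finset.Ico (2 ^ (ℓ - 1)) (2 ^ ℓ)) fun n hn => gfun_hasSum s hs n (hmem n hn)
    rw [← this.tsum_eq]
    refine tsum_congr fun m => ?_
    rw [Finset.mul_sum]
    rfl
end

section
/- Let s = σ + it with σ > 0 real, and let m ≥ 0 be an integer. Then |c*_{m,2}(s)| ≤ (Γ(σ+1)/|Γ(s+1)|) · 2^σ/(2^σ − 1), where Γ is the Gamma function. -/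
open Finset

lemma norm_Gamma_le (s : ℂ) (hs : 0 < s.re) : ‖Complex.Gamma s‖ ≤ Real.Gamma s.re := by
  rw [Complex.Gamma_eq_integral hs, Real.Gamma_eq_integral hs, Complex.GammaIntegral]
  refine (MeasureTheory.norm_integral_le_integral_norm _).trans (le_of_eq ?_)
  refine MeasureTheory.setIntegral_congr_fun measurableSet_Ioi ?_
  intro x hx
  have hx' : (0 : ℝ) < x := hx
  simp only [norm_mul]
  rw [Complex.norm_cpow_eq_rpow_re_of_pos hx', Complex.norm_real, Real.norm_eq_abs,
    abs_of_pos (Real.exp_pos _)]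
  simp

lemma binom_sum_le (σ : ℝ) (hσ : 0 < σ) (m : ℕ) : ∀ t : ℝ, 0 ≤ t →
    ∑ j ∈ Finset.range (m + 1),
      ((∏ i ∈ Finset.range j, (σ + m - i)) / (Nat.factorial j : ℝ)) * t ^ j
      ≤ (1 + t) ^ (σ + m) := by
  induction m with
  | zero =>
    intro t ht
    simpa using Real.one_le_rpow (by linarith : 1 ≤ 1 + t) hσ.le
  | succ m ih =>
    intro t ht
    have hsum : ∀ t : ℝ, ∑ j ∈ Finset.range (m + 1 + 1),
        ((∏ i ∈ Finset.range j, (σ + (m + 1 : ℕ) - i)) / (Nat.factorial j : ℝ)) * t ^ j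
        = (∑ j ∈ Finset.range (m + 1), (σ + m + 1) *
          (((∏ i ∈ Finset.range j, (σ + m - i)) / (Nat.factorial j : ℝ)) *
            (t ^ (j + 1) / (j + 1)))) + 1 := by
      intro t
      rw [Finset.sum_range_succ']
      congr 1
      · refine Finset.sum_congr rfl fun j _ => ?_
        rw [Finset.prod_range_succ']
        have : ∀ i : ℕ, σ + (m + 1 : ℕ) - ((i + 1 : ℕ) : ℝ) = σ + m - i := by
          intro i; push_cast; ring
        simp_rw [this]
        have h1 : (Nat.factorial j : ℝ) ≠ 0 := by positivity
        have h2 : (j : ℝ) + 1 ≠ 0 := by positivity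
        rw [Nat.factorial_succ]
        push_cast
        field_simp
        ring
      · simp
    rw [hsum]
    set D : ℝ → ℝ := fun t => (1 + t) ^ (σ + (m + 1 : ℕ)) -
      ((∑ j ∈ Finset.range (m + 1), (σ + m + 1) *
          (((∏ i ∈ Finset.range j, (σ + m - i)) / (Nat.factorial j : ℝ)) *
            (t ^ (j + 1) / (j + 1)))) + 1) with hD
    have hder : ∀ x : ℝ, 0 ≤ x → HasDerivAt D ((σ + m + 1) * ((1 + x) ^ (σ + m) -
        ∑ j ∈ Finset.range (m + 1),
          ((∏ i ∈ Finset.range j, (σ + m - i)) / (Nat.factorial j : ℝ)) * x ^ j)) x := by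
      intro x hx
      have h1 : HasDerivAt (fun t : ℝ => (1 + t) ^ (σ + (m + 1 : ℕ)))
          (1 * (σ + (m + 1 : ℕ)) * (1 + x) ^ (σ + (m + 1 : ℕ) - 1)) x :=
        ((hasDerivAt_id x).const_add 1).rpow_const (Or.inl (by simp; linarith))
      have h2 : HasDerivAt (fun t : ℝ => ∑ j ∈ Finset.range (m + 1), (σ + m + 1) *
          (((∏ i ∈ Finset.range j, (σ + m - i)) / (Nat.factorial j : ℝ)) *
            (t ^ (j + 1) / (j + 1)))) (∑ j ∈ Finset.range (m + 1), (σ + m + 1) *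
          (((∏ i ∈ Finset.range j, (σ + m - i)) / (Nat.factorial j : ℝ)) * x ^ j)) x := by
        refine HasDerivAt.fun_sum fun j _ => ?_
        refine HasDerivAt.const_mul _ (HasDerivAt.const_mul _ ?_)
        have h3 := (hasDerivAt_pow (j + 1) x).div_const ((j : ℝ) + 1)
        refine h3.congr_deriv ?_
        have h2 : (j : ℝ) + 1 ≠ 0 := by positivity
        push_cast
        field_simp
      refine HasDerivAt.congr_deriv (h1.sub (h2.add_const 1)) ?_
      rw [mul_sub, Finset.mul_sum]
      have : σ + ((m + 1 : ℕ) : ℝ) - 1 = σ + m := by push_cast; ring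
      rw [this]
      push_cast
      ring
    have hmono : MonotoneOn D (Set.Ici 0) := by
      refine monotoneOn_of_deriv_nonneg (convex_Ici 0)
        (fun x hx => (hder x hx).continuousAt.continuousWithinAt) ?_ ?_
      · intro x hx
        rw [interior_Ici] at hx
        exact (hder x (le_of_lt hx)).differentiableAt.differentiableWithinAt
      · intro x hx
        rw [interior_Ici] at hx
        rw [(hder x (le_of_lt hx)).deriv]
        have := ih x (le_of_lt hx)
        exact mul_nonneg (by positivity) (by linarith)
    have h0 := hmono (Set.mem_Ici.2 le_rfl) (Set.mem_Ici.2 ht) ht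
    have hD0 : D 0 = 0 := by simp [hD]
    rw [hD0] at h0
    simp only [hD] at h0
    linarith

/-- The weight comparing `s` to its real part. -/
noncomputable def wt (s : ℂ) (m : ℕ) : ℝ :=
  ∏ i ∈ Finset.range m, (‖s + i + 1‖ / (s.re + i + 1))

lemma wt_nonneg (s : ℂ) (hs : 0 < s.re) (m : ℕ) : 0 ≤ wt s m :=
  Finset.prod_nonneg fun i _ => by positivity

lemma wt_gamma (s : ℂ) (hs : 0 < s.re) (m : ℕ) :
    wt s m * (‖Complex.Gamma (s + 1)‖ * Real.Gamma (s.re + m + 1)) =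
      ‖Complex.Gamma (s + m + 1)‖ * Real.Gamma (s.re + 1) := by
  induction m with
  | zero => simp [wt]
  | succ m ih =>
    have hp : 0 < s.re + m + 1 := by positivity
    have hne : s + m + 1 ≠ 0 := by
      intro h
      have := congrArg Complex.re h
      simp at this
      linarith
    have e1 : Complex.Gamma (s + (m + 1 : ℕ) + 1) = (s + m + 1) * Complex.Gamma (s + m + 1) := by
      rw [← Complex.Gamma_add_one _ hne]; push_cast; ring_nf
    have e2 : Real.Gamma (s.re + (m + 1 : ℕ) + 1) =
        (s.re + m + 1) * Real.Gamma (s.re + m + 1) := by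
      rw [← Real.Gamma_add_one hp.ne']; push_cast; ring_nf
    rw [e1, e2, norm_mul, mul_assoc, ← ih]
    have : wt s (m + 1) = wt s m * (‖s + m + 1‖ / (s.re + m + 1)) := by
      rw [wt, Finset.prod_range_succ, ← wt]
    rw [this]
    field_simp

lemma wt_le (s : ℂ) (hs : 0 < s.re) (m : ℕ) :
    wt s m ≤ Real.Gamma (s.re + 1) / ‖Complex.Gamma (s + 1)‖ := by
  have h1 : 0 < ‖Complex.Gamma (s + 1)‖ :=
    norm_pos_iff.2 (Complex.Gamma_ne_zero_of_re_pos (by simp; linarith))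
  have h2 : 0 < Real.Gamma (s.re + m + 1) := Real.Gamma_pos_of_pos (by positivity)
  have h3 : 0 < Real.Gamma (s.re + 1) := Real.Gamma_pos_of_pos (by positivity)
  have h4 := norm_Gamma_le (s + m + 1) (by simp; positivity)
  simp only [Complex.add_re, Complex.natCast_re, Complex.one_re] at h4
  rw [le_div_iff₀ h1]
  refine le_of_mul_le_mul_right ?_ h2
  rw [mul_assoc, wt_gamma s hs m, mul_comm (Real.Gamma (s.re + 1))]
  exact mul_le_mul_of_nonneg_right h4 h3.le

lemma wt_shift (s : ℂ) (hs : 0 < s.re) (j k : ℕ) :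
    ‖∏ i ∈ Finset.range j, (s + ((k + j : ℕ) : ℂ) - i)‖ * wt s k =
      (∏ i ∈ Finset.range j, (s.re + ((k + j : ℕ) : ℝ) - i)) * wt s (k + j) := by
  induction j with
  | zero => simp
  | succ j ih =>
    rw [Finset.prod_range_succ', Finset.prod_range_succ', norm_mul]
    have e1 : ∀ i : ℕ, s + ((k + (j + 1) : ℕ) : ℂ) - ((i + 1 : ℕ) : ℂ)
        = s + ((k + j : ℕ) : ℂ) - i := by
      intro i; push_cast; ring
    have e2 : ∀ i : ℕ, s.re + ((k + (j + 1) : ℕ) : ℝ) - ((i + 1 : ℕ) : ℝ)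
        = s.re + ((k + j : ℕ) : ℝ) - i := by
      intro i; push_cast; ring
    simp_rw [e1, e2]
    have : wt s (k + (j + 1)) = wt s (k + j) *
        (‖s + ((k + j : ℕ) : ℂ) + 1‖ / (s.re + ((k + j : ℕ) : ℝ) + 1)) := by
      rw [← add_assoc, wt, Finset.prod_range_succ, ← wt]
    rw [this, mul_right_comm, ih]
    have hp : 0 < s.re + ((k + j : ℕ) : ℝ) + 1 := by positivity
    have e3 : s.re + ((k + (j + 1) : ℕ) : ℝ) - ((0 : ℕ) : ℝ) = s.re + ((k + j : ℕ) : ℝ) + 1 := by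
      push_cast; ring
    have e4 : s + ((k + (j + 1) : ℕ) : ℂ) - ((0 : ℕ) : ℂ) = s + ((k + j : ℕ) : ℂ) + 1 := by
      push_cast; ring
    rw [e3, e4]
    field_simp

lemma cstar_bound (s : ℂ) (hs : 0 < s.re) (m : ℕ) :
    ‖cstarC 2 s m‖ ≤ wt s m * (((2 : ℝ) ^ s.re - (1 / 2) ^ m) / ((2 : ℝ) ^ s.re - 1)) := by
  have hQ : 1 < (2 : ℝ) ^ s.re := Real.one_lt_rpow (by norm_num) hs
  have hQ' : 0 < (2 : ℝ) ^ s.re - 1 := by linarith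
  induction m using Nat.strong_induction_on with
  | _ m ih =>
  cases m with
  | zero =>
    rw [cstarC]
    simp [wt, div_self hQ'.ne']
  | succ m =>
    rw [cstarC]
    set B : ℝ := ((2 : ℝ) ^ s.re - (1 / 2) ^ m) / ((2 : ℝ) ^ s.re - 1) with hB
    have hpow : (2 : ℝ) ^ (s.re + ((m + 1 : ℕ) : ℝ)) = 2 ^ s.re * 2 ^ (m + 1) := by
      rw [Real.rpow_add (by norm_num), Real.rpow_natCast]
    have h2m : (1 : ℝ) ≤ 2 ^ m := one_le_pow₀ (by norm_num)
    have hden0 : 0 < (2 : ℝ) ^ s.re * 2 ^ (m + 1) - 2 := by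
      rw [pow_succ]; nlinarith
    have hden : (2 : ℝ) ^ s.re * 2 ^ (m + 1) - 2 ≤
        ‖((2 : ℕ) : ℂ) ^ (s + (m : ℂ) + 1) - ((2 : ℕ) : ℂ)‖ := by
      have h := norm_sub_norm_le (((2 : ℝ) : ℂ) ^ (s + (m : ℂ) + 1)) ((2 : ℝ) : ℂ)
      rw [Complex.norm_cpow_eq_rpow_re_of_pos (by norm_num), Complex.norm_real] at h
      have e : (s + (m : ℂ) + 1).re = s.re + ((m + 1 : ℕ) : ℝ) := by
        simp [add_assoc]
      rw [e, hpow] at h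
      simpa using h
    have hsum : ‖∑ j ∈ Finset.range (m + 1),
          ((∏ i ∈ Finset.range (j + 1), (s + (m : ℂ) + 1 - (i : ℂ))) / (Nat.factorial (j + 1) : ℂ))
            * (gammaNat 2 (j + 1) : ℂ) * cstarC 2 s (m - j)‖ ≤
        wt s (m + 1) * ((2 : ℝ) ^ s.re * 2 ^ (m + 1) - 1) * B := by
      have hterm : ∀ j ∈ Finset.range (m + 1),
          ‖((∏ i ∈ Finset.range (j + 1), (s + (m : ℂ) + 1 - (i : ℂ))) /
            (Nat.factorial (j + 1) : ℂ)) * (gammaNat 2 (j + 1) : ℂ) * cstarC 2 s (m - j)‖ ≤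
          ((∏ i ∈ Finset.range (j + 1), (s.re + ((m + 1 : ℕ) : ℝ) - i)) /
            (Nat.factorial (j + 1) : ℝ)) * (wt s (m + 1) * B) := by
        intro j hj
        have hj' : j < m + 1 := Finset.mem_range.1 hj
        have hg : gammaNat 2 (j + 1) = 1 := by simp [gammaNat]
        have hi := ih (m - j) (by omega)
        have hBle : ((2 : ℝ) ^ s.re - (1 / 2) ^ (m - j)) / ((2 : ℝ) ^ s.re - 1) ≤ B := by
          rw [hB]
          have : ((1 : ℝ) / 2) ^ m ≤ (1 / 2) ^ (m - j) :=
            pow_le_pow_of_le_one (by norm_num) (by norm_num) (by omega)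
          gcongr
        have hi' : ‖cstarC 2 s (m - j)‖ ≤ wt s (m - j) * B :=
          hi.trans (mul_le_mul_of_nonneg_left hBle (wt_nonneg s hs _))
        have hsh := wt_shift s hs (j + 1) (m - j)
        have e : m - j + (j + 1) = m + 1 := by omega
        rw [e] at hsh
        have e5 : ∀ i : ℕ, s + (m : ℂ) + 1 - (i : ℂ) = s + ((m + 1 : ℕ) : ℂ) - i := by
          intro i; push_cast; ring
        simp_rw [e5]
        rw [hg, norm_mul, norm_mul, norm_div, Complex.norm_natCast]
        simp only [Nat.cast_one, norm_one, mul_one]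
        calc _ ≤ ‖∏ i ∈ Finset.range (j + 1), (s + ((m + 1 : ℕ) : ℂ) - i)‖ /
              (Nat.factorial (j + 1) : ℝ) * (wt s (m - j) * B) :=
              mul_le_mul_of_nonneg_left hi' (by positivity)
          _ = (‖∏ i ∈ Finset.range (j + 1), (s + ((m + 1 : ℕ) : ℂ) - i)‖ * wt s (m - j)) /
              (Nat.factorial (j + 1) : ℝ) * B := by ring
          _ = _ := by rw [hsh]; ring
      have hbin := binom_sum_le s.re hs (m + 1) 1 zero_le_one
      rw [Finset.sum_range_succ', one_add_one_eq_two, hpow] at hbin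
      simp only [one_pow, mul_one, Finset.range_zero, Finset.prod_empty, Nat.factorial_zero,
        Nat.cast_one, div_one] at hbin
      have hB0 : 0 ≤ B := by
        have : ((1 : ℝ) / 2) ^ m ≤ 1 := pow_le_one₀ (by norm_num) (by norm_num)
        exact div_nonneg (by linarith) hQ'.le
      refine (norm_sum_le_of_le _ hterm).trans ?_
      rw [← Finset.sum_mul, mul_comm (wt s (m + 1)) ((2 : ℝ) ^ s.re * 2 ^ (m + 1) - 1), mul_assoc]
      refine mul_le_mul_of_nonneg_right ?_ (mul_nonneg (wt_nonneg s hs _) hB0)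
      push_cast at hbin ⊢
      linarith
    rw [norm_mul, norm_div, norm_one, one_div, inv_mul_le_iff₀ (hden0.trans_le hden)]
    refine hsum.trans ?_
    have hb1 : 0 ≤ wt s (m + 1) *
        (((2 : ℝ) ^ s.re - (1 / 2) ^ (m + 1)) / ((2 : ℝ) ^ s.re - 1)) := by
      have : ((1 : ℝ) / 2) ^ (m + 1) ≤ 1 := pow_le_one₀ (by norm_num) (by norm_num)
      exact mul_nonneg (wt_nonneg s hs _) (div_nonneg (by linarith) hQ'.le)
    refine le_trans (le_of_eq ?_) (mul_le_mul_of_nonneg_right hden hb1)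
    rw [hB, one_div, inv_pow, inv_pow, pow_succ]
    have : (2 : ℝ) ^ m ≠ 0 := by positivity
    field_simp

/-- For s with σ = Re s > 0 and m ≥ 0,
|c*_{m,2}(s)| ≤ (Γ(σ+1)/|Γ(s+1)|) · 2^σ/(2^σ − 1). -/
theorem cstar_abs_le_gamma_bound_b2 (s : ℂ) (hs : 0 < s.re) (m : ℕ) :
    ‖cstarC 2 s m‖ ≤
      (Real.Gamma (s.re + 1) / ‖Complex.Gamma (s + 1)‖) *
        ((2 : ℝ) ^ s.re / ((2 : ℝ) ^ s.re - 1)) := by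
  have hQ : 1 < (2 : ℝ) ^ s.re := Real.one_lt_rpow (by norm_num) hs
  have hQ' : 0 < (2 : ℝ) ^ s.re - 1 := by linarith
  refine (cstar_bound s hs m).trans ?_
  have h0 := wt_nonneg s hs m
  have h1 := wt_le s hs m
  have h2 : ((2 : ℝ) ^ s.re - (1 / 2) ^ m) / ((2 : ℝ) ^ s.re - 1) ≤
      (2 : ℝ) ^ s.re / ((2 : ℝ) ^ s.re - 1) := by
    gcongr
    have : (0 : ℝ) ≤ (1 / 2) ^ m := by positivity
    linarith
  exact (mul_le_mul_of_nonneg_left h2 h0).trans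
    (mul_le_mul_of_nonneg_right h1 (by positivity))
end

section
/- Let b > 1 be an integer and s a complex number with Re s > 0. Then the sequence (c*_{m,b}(s))_{m ≥ 0} is bounded: there exists C > 0 such that |c*_{m,b}(s)| ≤ C for all m ≥ 0. -/
open Finset

lemma aux_binom (x : ℝ) (hx : 0 < x) (m : ℕ) : ∀ a : ℝ, 0 ≤ a →
    ∑ j ∈ Finset.range (m + 1),
      ((∏ i ∈ Finset.range j, (x + (m : ℝ) - (i : ℝ))) / (Nat.factorial j : ℝ)) * a ^ j
      ≤ (1 + a) ^ (x + (m : ℝ)) := by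
  induction m with
  | zero =>
    intro a ha
    simp
    exact Real.one_le_rpow (by linarith) hx.le
  | succ m ih =>
    intro a ha
    let F : ℝ → ℝ := fun a => ∑ j ∈ Finset.range (m + 1 + 1),
      ((∏ i ∈ Finset.range j, (x + ((m + 1 : ℕ) : ℝ) - (i : ℝ))) / (Nat.factorial j : ℝ)) * a ^ j
    let F' : ℝ → ℝ := fun a => (x + (m : ℝ) + 1) * ∑ j ∈ Finset.range (m + 1),
      ((∏ i ∈ Finset.range j, (x + (m : ℝ) - (i : ℝ))) / (Nat.factorial j : ℝ)) * a ^ j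
    have hF : ∀ y, HasDerivAt F (F' y) y := by
      intro y
      have h1 : HasDerivAt F (∑ j ∈ Finset.range (m + 1 + 1),
          ((∏ i ∈ Finset.range j, (x + ((m + 1 : ℕ) : ℝ) - (i : ℝ))) / (Nat.factorial j : ℝ))
            * ((j : ℝ) * y ^ (j - 1))) y := by
        apply HasDerivAt.fun_sum
        intro j _
        exact (hasDerivAt_pow j y).const_mul _
      convert h1 using 1
      rw [Finset.sum_range_succ']
      simp only [F', Finset.mul_sum]
      simp only [Nat.cast_zero, zero_mul, mul_zero, add_zero, Nat.add_sub_cancel]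
      apply Finset.sum_congr rfl
      intro j _
      rw [Finset.prod_range_succ']
      have h2 : ∏ k ∈ Finset.range j, (x + ((m + 1 : ℕ) : ℝ) - ((k + 1 : ℕ) : ℝ))
          = ∏ k ∈ Finset.range j, (x + (m : ℝ) - (k : ℝ)) := by
        apply Finset.prod_congr rfl
        intro k _
        push_cast
        ring
      rw [h2, Nat.factorial_succ]
      have h3 : (Nat.factorial j : ℝ) ≠ 0 := by positivity
      have h4 : ((j : ℝ) + 1) ≠ 0 := by positivity
      push_cast
      field_simp
      ring
    let G : ℝ → ℝ := fun a => (1 + a) ^ (x + ((m + 1 : ℕ) : ℝ))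
    have hG : ∀ y, 0 ≤ y → HasDerivAt G ((x + (m : ℝ) + 1) * (1 + y) ^ (x + (m : ℝ))) y := by
      intro y hy
      have h := ((hasDerivAt_id y).const_add 1).rpow_const (p := x + ((m + 1 : ℕ) : ℝ))
        (Or.inl (by simp; linarith))
      refine h.congr_deriv ?_
      simp only [id]
      have : x + ((m + 1 : ℕ) : ℝ) - 1 = x + m := by push_cast; ring
      rw [this]
      push_cast
      ring
    have hmono : MonotoneOn (fun y => G y - F y) (Set.Ici 0) := by
      apply monotoneOn_of_hasDerivWithinAt_nonneg (convex_Ici 0)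
        (f' := fun y => (x + (m : ℝ) + 1) * (1 + y) ^ (x + (m : ℝ)) - F' y)
      · intro y hy
        exact ((hG y hy).sub (hF y)).continuousAt.continuousWithinAt
      · intro y hy
        rw [interior_Ici] at hy
        exact ((hG y (le_of_lt hy)).sub (hF y)).hasDerivWithinAt
      · intro y hy
        rw [interior_Ici] at hy
        have := ih y (le_of_lt hy)
        simp only [F']
        rw [← mul_sub]
        apply mul_nonneg
        · positivity
        · linarith
    have h0 := hmono (Set.mem_Ici.2 le_rfl) (Set.mem_Ici.2 ha) ha
    have hF0 : F 0 = 1 := by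
      simp only [F]
      rw [Finset.sum_range_succ']
      simp
    have hG0 : G 0 = 1 := by simp [G]
    simp only [hF0, hG0] at h0
    have : F a ≤ G a := by linarith
    exact this

lemma aux_norm (s : ℂ) (hs : 0 < s.re) (k : ℕ) :
    ‖s + ((k + 1 : ℕ) : ℂ)‖ ≤ (s.re + ((k + 1 : ℕ) : ℝ)) * (1 + s.im ^ 2 * (1 / ((k + 1 : ℕ) : ℝ) ^ 2)) := by
  set n : ℝ := ((k + 1 : ℕ) : ℝ) with hn
  have hn0 : 0 < n := by rw [hn]; positivity
  apply le_of_sq_le_sq _ (by positivity)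
  rw [Complex.sq_norm, Complex.normSq_apply]
  have h1 : (s + ((k + 1 : ℕ) : ℂ)).re = s.re + n := by simp [hn]
  have h2 : (s + ((k + 1 : ℕ) : ℂ)).im = s.im := by simp
  rw [h1, h2]
  have h3 : 1 ≤ (s.re + n) ^ 2 * (1 / n ^ 2) := by
    rw [mul_one_div, one_le_div (by positivity)]
    nlinarith
  have h4 : s.im ^ 2 ≤ s.im ^ 2 * ((s.re + n) ^ 2 * (1 / n ^ 2)) :=
    le_mul_of_one_le_right (sq_nonneg _) h3
  have h5 : 0 ≤ (s.re + n) ^ 2 * (s.im ^ 2 * (1 / n ^ 2)) ^ 2 := by positivity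
  nlinarith

lemma aux_prod (s : ℂ) (hs : 0 < s.re) (m : ℕ) (P : ℕ → ℝ)
    (hP : ∀ n, P n = ∏ k ∈ Finset.range n, (1 + s.im ^ 2 * (1 / ((k + 1 : ℕ) : ℝ) ^ 2))) :
    ∀ j, j ≤ m → (∏ i ∈ Finset.range j, ‖s + (m : ℂ) - (i : ℂ)‖) * P (m - j)
      ≤ (∏ i ∈ Finset.range j, (s.re + (m : ℝ) - (i : ℝ))) * P m := by
  intro j
  induction j with
  | zero => intro _; simp
  | succ j ih =>
    intro hj
    have ih := ih (by omega)
    obtain ⟨k, rfl⟩ : ∃ k, m = j + (k + 1) := ⟨m - j - 1, by omega⟩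
    have e1 : j + (k + 1) - (j + 1) = k := by omega
    have e2 : j + (k + 1) - j = k + 1 := by omega
    rw [e1]
    rw [e2, hP (k + 1), Finset.prod_range_succ, ← hP k] at ih
    rw [Finset.prod_range_succ, Finset.prod_range_succ]
    have h1 : s + ((j + (k + 1) : ℕ) : ℂ) - (j : ℂ) = s + ((k + 1 : ℕ) : ℂ) := by push_cast; ring
    have h2 : s.re + ((j + (k + 1) : ℕ) : ℝ) - (j : ℝ) = s.re + ((k + 1 : ℕ) : ℝ) := by
      push_cast; ring
    rw [h1, h2]
    have hPk : 0 ≤ P k := by rw [hP]; exact Finset.prod_nonneg fun i _ => by positivity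
    have hA : 0 ≤ ∏ i ∈ Finset.range j, ‖s + ((j + (k + 1) : ℕ) : ℂ) - (i : ℂ)‖ :=
      Finset.prod_nonneg fun i _ => norm_nonneg _
    have h3 := mul_le_mul_of_nonneg_left (aux_norm s hs k) (mul_nonneg hA hPk)
    have h4 := mul_le_mul_of_nonneg_left ih (a := s.re + ((k + 1 : ℕ) : ℝ)) (by positivity)
    nlinarith

lemma aux_sum (n : ℕ) (hn : 1 ≤ n) (x : ℝ) (hx : 0 < x) (m : ℕ) :
    ∑ j ∈ Finset.range (m + 1),
      ((∏ i ∈ Finset.range (j + 1), (x + ((m + 1 : ℕ) : ℝ) - (i : ℝ))) / (Nat.factorial (j + 1) : ℝ))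
        * (gammaNat (n + 1) (j + 1) : ℝ)
      ≤ ((n : ℝ) + 1) ^ (x + ((m + 1 : ℕ) : ℝ)) + ((n : ℝ) + 1) * (n : ℝ) ^ (x + ((m + 1 : ℕ) : ℝ)) := by
  set y := x + ((m + 1 : ℕ) : ℝ) with hy
  have hy0 : 0 ≤ y := by positivity
  calc _ = ∑ a ∈ Finset.Ico 1 (n + 1), ∑ j ∈ Finset.range (m + 1),
      ((∏ i ∈ Finset.range (j + 1), (y - (i : ℝ))) / (Nat.factorial (j + 1) : ℝ)) * (a : ℝ) ^ (j + 1) := by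
        rw [Finset.sum_comm]
        apply Finset.sum_congr rfl
        intro j _
        rw [gammaNat]
        push_cast
        rw [Finset.mul_sum]
    _ ≤ ∑ a ∈ Finset.Ico 1 (n + 1), (1 + (a : ℝ)) ^ y := by
        apply Finset.sum_le_sum
        intro a _
        have h := aux_binom x hx (m + 1) a (by positivity)
        rw [Finset.sum_range_succ'] at h
        simp only [Finset.range_zero, Finset.prod_empty, Nat.factorial_zero, pow_zero] at h
        rw [← hy] at h
        have : (0 : ℝ) ≤ 1 / ((1 : ℕ) : ℝ) * 1 := by positivity
        linarith
    _ ≤ _ := by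
        rw [Finset.sum_Ico_succ_top hn]
        have h1 : ∑ a ∈ Finset.Ico 1 n, (1 + (a : ℝ)) ^ y ≤ ∑ a ∈ Finset.Ico 1 n, (n : ℝ) ^ y := by
          apply Finset.sum_le_sum
          intro a ha
          rw [Finset.mem_Ico] at ha
          apply Real.rpow_le_rpow (by positivity) _ hy0
          have : 1 + a ≤ n := by omega
          exact_mod_cast this
        rw [Finset.sum_const, Nat.card_Ico, nsmul_eq_mul] at h1
        have h2 : ((n - 1 : ℕ) : ℝ) * (n : ℝ) ^ y ≤ ((n : ℝ) + 1) * (n : ℝ) ^ y := by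
          apply mul_le_mul_of_nonneg_right _ (by positivity)
          have : n - 1 ≤ n + 1 := by omega
          exact_mod_cast this
        rw [add_comm (n : ℝ) 1] at *
        linarith

lemma aux_ratio (n : ℕ) (hn : 1 ≤ n) (x : ℝ) (hx : 0 < x) :
    ∃ K : ℝ, 0 ≤ K ∧ ∀ m : ℕ, 0 < ((n : ℝ) + 1) ^ (x + ((m + 1 : ℕ) : ℝ)) - ((n : ℝ) + 1) ∧
      ((n : ℝ) + 1) ^ (x + ((m + 1 : ℕ) : ℝ)) + ((n : ℝ) + 1) * (n : ℝ) ^ (x + ((m + 1 : ℕ) : ℝ))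
      ≤ (1 + K * ((n : ℝ) / (n + 1)) ^ m) *
        (((n : ℝ) + 1) ^ (x + ((m + 1 : ℕ) : ℝ)) - ((n : ℝ) + 1)) := by
  have hn1 : (1 : ℝ) ≤ n := by exact_mod_cast hn
  set B : ℝ := (n : ℝ) + 1 with hB
  have hB1 : 1 < B := by linarith
  have hB0 : 0 < B := by linarith
  set δ : ℝ := 1 - B ^ (-x) with hδ
  have hδ0 : 0 < δ := by
    have := Real.rpow_lt_one_of_one_lt_of_neg hB1 (neg_lt_zero.2 hx)
    linarith
  refine ⟨2 * B / δ, by positivity, fun m => ?_⟩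
  set y := x + ((m + 1 : ℕ) : ℝ) with hy
  have hy0 : 0 ≤ y := by positivity
  have h1 : δ * B ^ y ≤ B ^ y - B := by
    have : B ≤ B ^ (-x) * B ^ y := by
      rw [← Real.rpow_add hB0]
      calc B = B ^ (1 : ℝ) := (Real.rpow_one B).symm
        _ ≤ _ := Real.rpow_le_rpow_of_exponent_le hB1.le (by rw [hy]; push_cast; linarith [(Nat.cast_nonneg m : (0:ℝ) ≤ m)])
    rw [hδ]; linarith
  have hBy : 0 < B ^ y := by positivity
  refine ⟨lt_of_lt_of_le (by positivity) h1, ?_⟩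
  set r : ℝ := (n : ℝ) / B with hr
  have hr0 : 0 < r := by positivity
  have hr1 : r ≤ 1 := by rw [hr, div_le_one hB0]; linarith
  have h2 : (n : ℝ) ^ y ≤ r ^ m * B ^ y := by
    have : (n : ℝ) = r * B := by rw [hr]; field_simp
    rw [this, Real.mul_rpow hr0.le hB0.le, ← Real.rpow_natCast r m]
    apply mul_le_mul_of_nonneg_right _ hBy.le
    apply Real.rpow_le_rpow_of_exponent_ge hr0 hr1
    rw [hy]; push_cast; linarith
  have h3 : 1 ≤ (n : ℝ) ^ y := Real.one_le_rpow hn1 hy0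
  have h4 : 2 * B * (r ^ m * B ^ y) ≤ 2 * B / δ * r ^ m * (B ^ y - B) := by
    calc 2 * B * (r ^ m * B ^ y) = 2 * B / δ * r ^ m * (δ * B ^ y) := by field_simp
      _ ≤ _ := mul_le_mul_of_nonneg_left h1 (by positivity)
  have h5 := mul_le_mul_of_nonneg_left h2 (a := 2 * B) (by positivity)
  have h6 := mul_le_mul_of_nonneg_left h3 hB0.le
  nlinarith

lemma aux_bdd (u : ℕ → ℝ) (hu : ∀ n, 0 ≤ u n) (hs : Summable u) (m : ℕ) :
    ∏ k ∈ Finset.range m, (1 + u k) ≤ Real.exp (∑' k, u k) := by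
  calc _ ≤ ∏ k ∈ Finset.range m, Real.exp (u k) := by
        apply Finset.prod_le_prod
        · intro k _; linarith [hu k]
        · intro k _; linarith [Real.add_one_le_exp (u k)]
    _ = Real.exp (∑ k ∈ Finset.range m, u k) := (Real.exp_sum _ _).symm
    _ ≤ _ := Real.exp_le_exp.2 (hs.sum_le_tsum _ (fun k _ => hu k))

/-- For b > 1 and Re s > 0, the sequence (c*_{m,b}(s))ₘ is bounded. -/
theorem cstar_bounded (b : ℕ) (hb : 1 < b) (s : ℂ) (hs : 0 < s.re) :
    ∃ C : ℝ, 0 < C ∧ ∀ m : ℕ, ‖cstarC b s m‖ ≤ C := by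
  obtain ⟨n, rfl⟩ : ∃ n, b = n + 1 := ⟨b - 1, by omega⟩
  have hn : 1 ≤ n := by omega
  obtain ⟨K, hK, hr⟩ := aux_ratio n hn s.re hs
  let u : ℕ → ℝ := fun k => s.im ^ 2 * (1 / ((k + 1 : ℕ) : ℝ) ^ 2)
  let v : ℕ → ℝ := fun k => K * ((n : ℝ) / (n + 1)) ^ k
  have hu0 : ∀ k, 0 ≤ u k := fun k => by positivity
  have hv0 : ∀ k, 0 ≤ v k := fun k => by positivity
  have hus : Summable u :=
    ((summable_nat_add_iff 1).2 (Real.summable_one_div_nat_pow.2 one_lt_two)).mul_left _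
  have hvs : Summable v := by
    apply (summable_geometric_of_lt_one (by positivity) _).mul_left
    rw [div_lt_one (by positivity)]
    linarith
  obtain ⟨P, hP⟩ : ∃ P : ℕ → ℝ, ∀ m, P m = ∏ k ∈ Finset.range m, (1 + u k) := ⟨_, fun _ => rfl⟩
  obtain ⟨Q, hQ⟩ : ∃ Q : ℕ → ℝ, ∀ m, Q m = ∏ k ∈ Finset.range m, (1 + v k) := ⟨_, fun _ => rfl⟩
  have hP0 : ∀ m, 0 ≤ P m := fun m => by
    rw [hP]; exact Finset.prod_nonneg fun i _ => by linarith [hu0 i]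
  have hQ0 : ∀ m, 0 ≤ Q m := fun m => by
    rw [hQ]; exact Finset.prod_nonneg fun i _ => by linarith [hv0 i]
  have hQmono : Monotone Q := by
    apply monotone_nat_of_le_succ
    intro m
    rw [hQ (m + 1), Finset.prod_range_succ, ← hQ]
    exact le_mul_of_one_le_right (hQ0 m) (by linarith [hv0 m])
  have key : ∀ m, ‖cstarC (n + 1) s m‖ ≤ P m * Q m := by
    intro m
    induction m using Nat.strong_induction_on with
    | _ m ih =>
    cases m with
    | zero => simp [cstarC, hP, hQ]
    | succ m =>
      rw [cstarC, norm_mul, norm_div, norm_one]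
      obtain ⟨hd0, hrm⟩ := hr m
      have hden : ((n : ℝ) + 1) ^ (s.re + ((m + 1 : ℕ) : ℝ)) - ((n : ℝ) + 1) ≤
          ‖(((n + 1 : ℕ) : ℂ) ^ (s + (m : ℂ) + 1) - ((n + 1 : ℕ) : ℂ))‖ := by
        refine le_trans (le_of_eq ?_) (norm_sub_norm_le _ _)
        rw [Complex.norm_natCast_cpow_of_pos (by omega), Complex.norm_natCast]
        congr 2
        · push_cast; ring
        · simp; ring
        · push_cast; ring
      set d := ((n : ℝ) + 1) ^ (s.re + ((m + 1 : ℕ) : ℝ)) - ((n : ℝ) + 1) with hd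
      have hsum : ‖∑ j ∈ Finset.range (m + 1),
          ((∏ i ∈ Finset.range (j + 1), (s + (m : ℂ) + 1 - (i : ℂ))) / (Nat.factorial (j + 1) : ℂ))
            * (gammaNat (n + 1) (j + 1) : ℂ) * cstarC (n + 1) s (m - j)‖ ≤
          (P (m + 1) * Q m) * ∑ j ∈ Finset.range (m + 1),
      ((∏ i ∈ Finset.range (j + 1), (s.re + ((m + 1 : ℕ) : ℝ) - (i : ℝ))) / (Nat.factorial (j + 1) : ℝ))
        * (gammaNat (n + 1) (j + 1) : ℝ) := by
        refine (norm_sum_le _ _).trans ?_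
        rw [Finset.mul_sum]
        apply Finset.sum_le_sum
        intro j hj
        rw [Finset.mem_range] at hj
        have hp := aux_prod s hs (m + 1) P hP (j + 1) (by omega)
        have e : m + 1 - (j + 1) = m - j := by omega
        rw [e] at hp
        rw [norm_mul, norm_mul, norm_div, norm_prod, Complex.norm_natCast, Complex.norm_natCast]
        have e2 : ∏ i ∈ Finset.range (j + 1), ‖s + (m : ℂ) + 1 - (i : ℂ)‖ =
            ∏ i ∈ Finset.range (j + 1), ‖s + ((m + 1 : ℕ) : ℂ) - (i : ℂ)‖ := by
          apply Finset.prod_congr rfl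
          intro i _
          push_cast
          rw [add_assoc]
        rw [e2]
        set A := ∏ i ∈ Finset.range (j + 1), ‖s + ((m + 1 : ℕ) : ℂ) - (i : ℂ)‖ with hA
        set A' := ∏ i ∈ Finset.range (j + 1), (s.re + ((m + 1 : ℕ) : ℝ) - (i : ℝ)) with hA'
        have hA0 : 0 ≤ A := Finset.prod_nonneg fun i _ => norm_nonneg _
        have hc : ‖cstarC (n + 1) s (m - j)‖ ≤ P (m - j) * Q m :=
          (ih (m - j) (by omega)).trans
            (mul_le_mul_of_nonneg_left (hQmono (Nat.sub_le m j)) (hP0 _))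
        set g : ℝ := (gammaNat (n + 1) (j + 1) : ℝ) with hg
        have hg0 : 0 ≤ g := by positivity
        set f : ℝ := (Nat.factorial (j + 1) : ℝ) with hf
        have hf0 : 0 < f := by positivity
        calc A / f * g * ‖cstarC (n + 1) s (m - j)‖ ≤ A / f * g * (P (m - j) * Q m) :=
              mul_le_mul_of_nonneg_left hc (by positivity)
          _ = (A * P (m - j)) * (Q m * g / f) := by ring
          _ ≤ (A' * P (m + 1)) * (Q m * g / f) :=
              mul_le_mul_of_nonneg_right hp
                (div_nonneg (mul_nonneg (hQ0 m) hg0) hf0.le)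
          _ = _ := by ring
      have hsum2 := hsum.trans (mul_le_mul_of_nonneg_left
        ((aux_sum n hn s.re hs m).trans hrm) (mul_nonneg (hP0 (m + 1)) (hQ0 m)))
      rw [one_div_mul_eq_div]
      rw [div_le_iff₀ (hd0.trans_le hden)]
      refine hsum2.trans ?_
      rw [hQ (m + 1), Finset.prod_range_succ, ← hQ m]
      calc P (m + 1) * Q m * ((1 + K * ((n : ℝ) / (n + 1)) ^ m) * d)
          = P (m + 1) * (Q m * (1 + v m)) * d := by simp only [v]; ring
        _ ≤ _ := mul_le_mul_of_nonneg_left hden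
            (mul_nonneg (hP0 _) (mul_nonneg (hQ0 m) (by linarith [hv0 m])))
  refine ⟨Real.exp (∑' k, u k) * Real.exp (∑' k, v k), by positivity, fun m => ?_⟩
  refine (key m).trans (mul_le_mul ?_ ?_ (hQ0 m) (by positivity))
  · rw [hP]; exact aux_bdd u hu0 hus m
  · rw [hQ]; exact aux_bdd v hv0 hvs m
end
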